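/- Let q ≥ 2 be an integer, let H ∈ (1 − 1/(2q), 1), and let (B_t)_{t≥0} be a fractional Brownian motion with Hurst index H. For n ≥ 1 define Z_n = n^{q(1−H)−1} Σ_{k=0}^{n−1} H_q(n^H (B_{(k+1)/n} − B_{k/n})). Then, as n, m → ∞ (jointly), E[Z_n Z_m] → q! H^q (2H−1)^q ∫_{[0,1]²} |u−v|^{(2H−2)q} du dv, and this limit is finite. In particular (Z_n) is a Cauchy sequence in L²(Ω). -/

import Mathlib

open MeasureTheory ProbabilityTheory Filter Topology

/-- All moments finite. -/
def AllLp {Ω : Type*} {mΩ : MeasurableSpace Ω} (μ : Measure Ω) (X : Ω → ℝ) : Prop :=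
  ∀ p : ENNReal, p ≠ ⊤ → MemLp X p μ

namespace AllLp
variable {Ω : Type*} {mΩ : MeasurableSpace Ω} {μ : Measure Ω} {X Y : Ω → ℝ}

lemma add (hX : AllLp μ X) (hY : AllLp μ Y) : AllLp μ (fun ω => X ω + Y ω) :=
  fun p hp => (hX p hp).add (hY p hp)

lemma mul (hX : AllLp μ X) (hY : AllLp μ Y) : AllLp μ (fun ω => X ω * Y ω) := by
  intro p hp
  have h2 : p * 2 ≠ ⊤ := ENNReal.mul_ne_top hp (by simp)
  have : ENNReal.HolderTriple (p * 2) (p * 2) p := ⟨by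
    rw [ENNReal.mul_inv (by simp) (by simp), ← mul_add, ENNReal.inv_two_add_inv_two, mul_one]⟩
  exact (hY _ h2).mul' (hX _ h2)

lemma const [IsFiniteMeasure μ] (c : ℝ) : AllLp μ (fun _ => c) := fun _ _ => memLp_const c

lemma poly [IsFiniteMeasure μ] (hX : AllLp μ X) (p : Polynomial ℝ) :
    AllLp μ (fun ω => p.eval (X ω)) := by
  induction p using Polynomial.induction_on with
  | C a => simpa using const a
  | add p r hp hr => simpa using hp.add hr
  | monomial n a ih =>
    have := ih.mul hX
    simpa [pow_succ, mul_assoc] using this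

lemma sum [IsFiniteMeasure μ] {ι : Type*} (s : Finset ι) {X : ι → Ω → ℝ}
    (hX : ∀ i ∈ s, AllLp μ (X i)) : AllLp μ (fun ω => ∑ i ∈ s, X i ω) :=
  fun p hp => memLp_finsetSum s fun i hi => hX i hi p hp

lemma integrable (hX : AllLp μ X) : Integrable X μ := memLp_one_iff_integrable.1 (hX 1 (by simp))

end AllLp

lemma allLp_id_gaussian (v : NNReal) : AllLp (gaussianReal 0 v) (fun x => x) :=
  fun p hp => memLp_id_gaussianReal' p hp

lemma stein_one (p : Polynomial ℝ) :
    ∫ x, x * p.eval x ∂gaussianReal 0 1 = ∫ x, p.derivative.eval x ∂gaussianReal 0 1 := by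
  have hint : ∀ r : Polynomial ℝ, Integrable (fun x => r.eval x * gaussianPDFReal 0 1 x) := by
    intro r
    have h := ((allLp_id_gaussian 1).poly r).integrable
    rw [gaussianReal_of_var_ne_zero _ one_ne_zero,
      integrable_withDensity_iff_integrable_smul' (measurable_gaussianPDF 0 1)
        (Eventually.of_forall fun x => gaussianPDF_lt_top)] at h
    refine h.congr (Eventually.of_forall fun x => ?_)
    simp [toReal_gaussianPDF, mul_comm]
  have hd : ∀ x, HasDerivAt (gaussianPDFReal 0 1) (-x * gaussianPDFReal 0 1 x) x := by
    intro x
    simp only [gaussianPDFReal_def]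
    have h1 : HasDerivAt (fun x : ℝ => -(x - 0) ^ 2 / (2 * ((1 : NNReal) : ℝ))) (-x) x := by
      have := (((hasDerivAt_id x).pow 2).neg).div_const 2
      simp at this ⊢
      refine this.congr_deriv ?_
      ring
    have := h1.exp.const_mul ((√(2 * Real.pi * ((1 : NNReal) : ℝ)))⁻¹)
    refine this.congr_deriv ?_
    ring
  have key := integral_mul_deriv_eq_deriv_mul_of_integrable
    (u := fun x => p.eval x) (u' := fun x => p.derivative.eval x)
    (v := gaussianPDFReal 0 1) (v' := fun x => -x * gaussianPDFReal 0 1 x)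
    (fun x _ => p.hasDerivAt x) (fun x _ => hd x)
    (by
      refine (hint (-(Polynomial.X * p))).congr (Eventually.of_forall fun x => ?_)
      simp; ring)
    (hint _) (hint _)
  rw [integral_gaussianReal_eq_integral_smul one_ne_zero,
    integral_gaussianReal_eq_integral_smul one_ne_zero]
  have e1 : ∫ x, gaussianPDFReal 0 1 x • (x * p.eval x)
      = - ∫ x, p.eval x * (-x * gaussianPDFReal 0 1 x) := by
    rw [← integral_neg]; congr 1; ext x; simp; ring
  rw [e1, key, neg_neg]; congr 1; ext x; simp; ring

lemma stein_two {Ω : Type*} {mΩ : MeasurableSpace Ω} (μ : Measure Ω) [IsProbabilityMeasure μ]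
    (X Y : Ω → ℝ) (hXY : HasGaussianLaw (fun ω => (X ω, Y ω)) μ)
    (hX : μ.map X = gaussianReal 0 1)
    (p r : Polynomial ℝ) :
    ∫ ω, X ω * p.eval (X ω) * r.eval (Y ω) ∂μ =
      ∫ ω, p.derivative.eval (X ω) * r.eval (Y ω) ∂μ +
      (∫ ω, X ω * Y ω ∂μ) * ∫ ω, p.eval (X ω) * r.derivative.eval (Y ω) ∂μ := by
  set ρ := ∫ ω, X ω * Y ω ∂μ with hρ
  have hXm : AEMeasurable X μ := hXY.fst.aemeasurable
  have hYm : AEMeasurable Y μ := hXY.snd.aemeasurable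
  have aX : AllLp μ X := fun p hp => hXY.fst.memLp hp
  have aY : AllLp μ Y := fun p hp => hXY.snd.memLp hp
  set W : Ω → ℝ := fun ω => Y ω - ρ * X ω with hW
  have hX0 : ∫ ω, X ω ∂μ = 0 := by
    have := integral_map hXm (f := fun x : ℝ => x) (by fun_prop)
    rw [← this, hX, integral_id_gaussianReal]
  have hX2 : ∫ ω, X ω * X ω ∂μ = 1 := by
    have h1 := integral_map hXm (f := fun x : ℝ => x * x) (by fun_prop)
    rw [← h1, hX]
    have := stein_one Polynomial.X
    simpa using this
  have hXW : HasGaussianLaw (fun ω => (X ω, W ω)) μ := by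
    have := hXY.map_fun ((ContinuousLinearMap.fst ℝ ℝ ℝ).prod
      (ContinuousLinearMap.snd ℝ ℝ ℝ - ρ • ContinuousLinearMap.fst ℝ ℝ ℝ))
    simpa [hW] using this
  have aW : AllLp μ W := fun p hp => hXW.snd.memLp hp
  have hWm : AEMeasurable W μ := hXW.snd.aemeasurable
  have hcov : cov[X, W; μ] = 0 := by
    rw [covariance_eq_sub (aX 2 (by simp)) (aW 2 (by simp)), hX0, zero_mul, sub_zero]
    have : ∀ ω, (X * W) ω = X ω * Y ω - ρ * (X ω * X ω) := by
      intro ω; simp [hW]; ring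
    rw [integral_congr_ae (Eventually.of_forall this), integral_sub (aX.mul aY).integrable
      ((aX.mul aX).integrable.const_mul _), integral_const_mul, hX2]
    simp [hρ]
  have hind := hXW.indepFun_of_covariance_eq_zero hcov
  have hlaw := (indepFun_iff_map_prod_eq_prod_map_map hXm hWm).1 hind
  set ν := μ.map W with hν
  have : IsProbabilityMeasure ν := Measure.isProbabilityMeasure_map hWm
  rw [hX] at hlaw
  set γ := gaussianReal 0 1 with hγ
  -- moments on the product space
  have a1 : AllLp (γ.prod ν) (fun z : ℝ × ℝ => z.1) := by
    intro p hp
    rw [← hlaw]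
    exact (memLp_map_measure_iff (by fun_prop) (hXm.prodMk hWm)).2 (aX p hp)
  have a2 : AllLp (γ.prod ν) (fun z : ℝ × ℝ => z.2) := by
    intro p hp
    rw [← hlaw]
    exact (memLp_map_measure_iff (by fun_prop) (hXm.prodMk hWm)).2 (aW p hp)
  have a3 : AllLp (γ.prod ν) (fun z : ℝ × ℝ => ρ * z.1 + z.2) := ((AllLp.const ρ).mul a1).add a2
  have tr : ∀ g : ℝ × ℝ → ℝ, Continuous g →
      ∫ ω, g (X ω, W ω) ∂μ = ∫ z, g z ∂(γ.prod ν) := by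
    intro g hg
    rw [← hlaw, integral_map (hXm.prodMk hWm) hg.aestronglyMeasurable]
  have hYW : ∀ ω, Y ω = ρ * X ω + W ω := fun ω => by simp [hW]
  have t1 := tr (fun z => z.1 * p.eval z.1 * r.eval (ρ * z.1 + z.2)) (by fun_prop)
  have t2 := tr (fun z => p.derivative.eval z.1 * r.eval (ρ * z.1 + z.2)) (by fun_prop)
  have t3 := tr (fun z => p.eval z.1 * r.derivative.eval (ρ * z.1 + z.2)) (by fun_prop)
  simp only [← hYW] at t1 t2 t3
  rw [t1, t2, t3, ← integral_const_mul, ← integral_add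
    ((a1.poly _).mul (a3.poly _)).integrable
    (((a1.poly _).mul (a3.poly _)).integrable.const_mul _),
    integral_prod_symm _ ((a1.mul (a1.poly _)).mul (a3.poly _)).integrable,
    integral_prod_symm _ (((a1.poly _).mul (a3.poly _)).add
      ((AllLp.const ρ).mul ((a1.poly _).mul (a3.poly _)))).integrable]
  congr 1
  ext w
  have := stein_one (p * r.comp (Polynomial.C ρ * Polynomial.X + Polynomial.C w))
  simp [Polynomial.derivative_comp] at this
  rw [← hγ] at this
  simp only [mul_assoc] at this ⊢
  rw [this]
  congr 1
  ext x
  ring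

lemma hermite_cov {Ω : Type*} {mΩ : MeasurableSpace Ω} (μ : Measure Ω) [IsProbabilityMeasure μ]
    (X Y : Ω → ℝ) (hXY : HasGaussianLaw (fun ω => (X ω, Y ω)) μ)
    (hX : μ.map X = gaussianReal 0 1) (q : ℕ) :
    ∫ ω, (Polynomial.aeval (X ω) (Polynomial.hermite q) : ℝ) *
      (Polynomial.aeval (Y ω) (Polynomial.hermite q) : ℝ) ∂μ =
      (q.factorial : ℝ) * (∫ ω, X ω * Y ω ∂μ) ^ q := by
  set ρ := ∫ ω, X ω * Y ω ∂μ with hρ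
  have aX : AllLp μ X := fun p hp => hXY.fst.memLp hp
  have aY : AllLp μ Y := fun p hp => hXY.snd.memLp hp
  let h : ℕ → Polynomial ℝ := fun k => (Polynomial.hermite k).map (Int.castRingHom ℝ)
  have hh : ∀ k x, (Polynomial.aeval x (Polynomial.hermite k) : ℝ) = (h k).eval x := by
    intro k x
    simp [h, Polynomial.aeval_def, Polynomial.eval_map]
  have step : ∀ k (r : Polynomial ℝ), ∫ ω, (h (k+1)).eval (X ω) * r.eval (Y ω) ∂μ =
      ρ * ∫ ω, (h k).eval (X ω) * r.derivative.eval (Y ω) ∂μ := by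
    intro k r
    have s := stein_two μ X Y hXY hX (h k) r
    have e : ∀ ω, (h (k+1)).eval (X ω) * r.eval (Y ω) =
      X ω * (h k).eval (X ω) * r.eval (Y ω) - (h k).derivative.eval (X ω) * r.eval (Y ω) := by
      intro ω
      simp [h, Polynomial.hermite_succ, Polynomial.derivative_map]; ring
    simp_rw [e]
    rw [integral_sub ((aX.mul (aX.poly _)).mul (aY.poly _)).integrable
      ((aX.poly _).mul (aY.poly _)).integrable, s]
    ring
  have iter : ∀ k (r : Polynomial ℝ), ∫ ω, (h k).eval (X ω) * r.eval (Y ω) ∂μ =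
      ρ ^ k * ∫ ω, (Polynomial.derivative^[k] r).eval (Y ω) ∂μ := by
    intro k
    induction k with
    | zero => intro r; simp [h]
    | succ k ih => intro r; rw [step, ih]; simp [pow_succ]; ring
  simp_rw [hh]
  rw [iter]
  have hdq : Polynomial.derivative^[q] (h q) = Polynomial.C (q.factorial : ℝ) := by
    have hm : (h q).Monic := (Polynomial.hermite_monic q).map _
    have hn : (h q).natDegree = q := by
      rw [(Polynomial.hermite_monic q).natDegree_map, Polynomial.natDegree_hermite]
    have := Polynomial.natDegree_iterate_derivative (h q) q
    rw [hn, Nat.sub_self, Nat.le_zero] at this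
    rw [Polynomial.eq_C_of_natDegree_eq_zero this, Polynomial.coeff_iterate_derivative]
    have : (h q).coeff q = 1 := by rw [← hn]; rw [hn]; simpa [Polynomial.Monic, Polynomial.leadingCoeff, hn] using hm
    simp [this, Nat.descFactorial_self]
  rw [hdq]
  simp [mul_comm]

lemma absrpow_ii {β : ℝ} (hβ : -1 < β) (a b : ℝ) :
    IntervalIntegrable (fun x : ℝ => |x| ^ β) volume a b := by
  have pos : ∀ c : ℝ, 0 ≤ c → IntervalIntegrable (fun x : ℝ => |x| ^ β) volume 0 c := by
    intro c hc
    refine (intervalIntegral.intervalIntegrable_rpow' hβ (a := 0) (b := c)).congr ?_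
    intro x hx
    rw [Set.uIoc_of_le hc] at hx
    simp [abs_of_pos hx.1]
  have all : ∀ c : ℝ, IntervalIntegrable (fun x : ℝ => |x| ^ β) volume 0 c := by
    intro c
    rcases le_total 0 c with hc | hc
    · exact pos c hc
    · have := pos (-c) (by linarith)
      have h2 := (IntervalIntegrable.iff_comp_neg (f := fun x : ℝ => |x| ^ β) (a := 0) (b := c)
        (by simp)).2
      simp only [abs_neg, neg_zero] at h2
      exact h2 this
  exact (all a).symm.trans (all b)

lemma diag_int {β : ℝ} (hβ : -1 < β) :
    IntegrableOn (fun p : ℝ × ℝ => |p.1 - p.2| ^ β) (Set.Icc (0 : ℝ) 1 ×ˢ Set.Icc (0 : ℝ) 1) := by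
  have hf : Integrable ((Set.Icc (0 : ℝ) 1).indicator (fun _ => (1 : ℝ))) :=
    (integrable_indicator_iff measurableSet_Icc).2 (by simp)
  have hg : Integrable ((Set.Icc (-1 : ℝ) 1).indicator (fun x => |x| ^ β)) := by
    rw [integrable_indicator_iff measurableSet_Icc]
    have := absrpow_ii hβ (-1) 1
    rwa [intervalIntegrable_iff_integrableOn_Icc_of_le (by norm_num)] at this
  have h := (hf.convolution_integrand (ContinuousLinearMap.mul ℝ ℝ) hg)
  rw [← Measure.volume_eq_prod] at h
  refine (h.integrableOn (s := Set.Icc (0 : ℝ) 1 ×ˢ Set.Icc (0 : ℝ) 1)).congr_fun ?_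
    (measurableSet_Icc.prod measurableSet_Icc)
  rintro ⟨x, y⟩ ⟨hx, hy⟩
  have hxy : x - y ∈ Set.Icc (-1 : ℝ) 1 := ⟨by linarith [hx.1, hy.2], by linarith [hx.2, hy.1]⟩
  simp only at hx hy
  simp [Set.indicator_of_mem hy, Set.indicator_of_mem hxy]

lemma diag_ne_ae (S : Set (ℝ × ℝ)) : ∀ᵐ p : ℝ × ℝ ∂(volume.restrict S), p.1 ≠ p.2 := by
  refine ae_restrict_of_ae ?_
  rw [ae_iff, Measure.volume_eq_prod]
  simp only [ne_eq, not_not]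
  rw [Measure.measure_prod_null (measurableSet_eq_fun measurable_fst measurable_snd)]
  refine Eventually.of_forall fun x => ?_
  have : (Prod.mk x ⁻¹' {a : ℝ × ℝ | a.1 = a.2}) = {x} := by ext y; simp [eq_comm]
  change volume (Prod.mk x ⁻¹' {a : ℝ × ℝ | a.1 = a.2}) = 0
  rw [this]; simp

/-- signed power -/
noncomputable def spow (γ x : ℝ) : ℝ := (max x 0) ^ γ - (max (-x) 0) ^ γ

lemma spow_cont {γ : ℝ} (hγ : 0 ≤ γ) : Continuous (spow γ) := by
  unfold spow
  exact ((continuous_id.max continuous_const).rpow_const fun _ => Or.inr hγ).sub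
    ((continuous_neg.max continuous_const).rpow_const fun _ => Or.inr hγ)

lemma spow_pos {γ x : ℝ} (hγ : 0 < γ) (hx : 0 < x) : spow γ x = x ^ γ := by
  simp [spow, max_eq_left hx.le, max_eq_right (neg_nonpos.2 hx.le), Real.zero_rpow hγ.ne']

lemma spow_neg {γ x : ℝ} (hγ : 0 < γ) (hx : x < 0) : spow γ x = -(-x) ^ γ := by
  simp [spow, max_eq_right hx.le, max_eq_left (neg_nonneg.2 hx.le), Real.zero_rpow hγ.ne']

lemma integral_absrpow {β : ℝ} (hβ : -1 < β) (a b : ℝ) :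
    ∫ x in a..b, |x| ^ β = (spow (β + 1) b - spow (β + 1) a) / (β + 1) := by
  have h1 : 0 < β + 1 := by linarith
  rw [sub_div]
  refine integral_eq_of_hasDerivAt_off_countable (fun x => spow (β + 1) x / (β + 1))
    (fun x => |x| ^ β) (Set.countable_singleton (0 : ℝ))
    ((spow_cont h1.le).div_const _).continuousOn ?_ (absrpow_ii hβ a b)
  rintro x ⟨-, hx⟩
  rcases lt_or_gt_of_ne (show x ≠ 0 from hx) with hx | hx
  · have e : (fun x => spow (β + 1) x / (β + 1)) =ᶠ[𝓝 x] fun x => -(-x) ^ (β + 1) / (β + 1) := by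
      filter_upwards [gt_mem_nhds hx] with y hy
      rw [spow_neg h1 hy]
    refine HasDerivAt.congr_of_eventuallyEq ?_ e
    have := (((hasDerivAt_neg x).rpow_const (p := β + 1)
      (Or.inl (by simpa using hx.ne))).neg).div_const (β + 1)
    refine this.congr_deriv ?_
    rw [abs_of_neg hx]; simp; field_simp; ring
  · have e : (fun x => spow (β + 1) x / (β + 1)) =ᶠ[𝓝 x] fun x => x ^ (β + 1) / (β + 1) := by
      filter_upwards [lt_mem_nhds hx] with y hy
      rw [spow_pos h1 hy]
    refine HasDerivAt.congr_of_eventuallyEq ?_ e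
    have := ((hasDerivAt_id x).rpow_const (p := β + 1) (Or.inl hx.ne')).div_const (β + 1)
    refine this.congr_deriv ?_
    rw [abs_of_pos hx]; simp; field_simp

lemma integral_spow {γ : ℝ} (hγ : 0 < γ) (a b : ℝ) :
    ∫ x in a..b, spow γ x = (|b| ^ (γ + 1) - |a| ^ (γ + 1)) / (γ + 1) := by
  have h1 : 0 < γ + 1 := by linarith
  rw [sub_div]
  refine integral_eq_of_hasDerivAt_off_countable (fun x => |x| ^ (γ + 1) / (γ + 1))
    (fun x => spow γ x) (Set.countable_singleton (0 : ℝ))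
    ((continuous_abs.rpow_const fun _ => Or.inr h1.le).div_const _).continuousOn ?_
    ((spow_cont hγ.le).intervalIntegrable _ _)
  rintro x ⟨-, hx⟩
  rcases lt_or_gt_of_ne (show x ≠ 0 from hx) with hx | hx
  · have e : (fun x => |x| ^ (γ + 1) / (γ + 1)) =ᶠ[𝓝 x] fun x => (-x) ^ (γ + 1) / (γ + 1) := by
      filter_upwards [gt_mem_nhds hx] with y hy
      rw [abs_of_neg hy]
    refine HasDerivAt.congr_of_eventuallyEq ?_ e
    have := ((hasDerivAt_neg x).rpow_const (p := γ + 1)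
      (Or.inl (by simpa using hx.ne))).div_const (γ + 1)
    refine this.congr_deriv ?_
    rw [spow_neg hγ hx]; simp; field_simp; ring
  · have e : (fun x => |x| ^ (γ + 1) / (γ + 1)) =ᶠ[𝓝 x] fun x => x ^ (γ + 1) / (γ + 1) := by
      filter_upwards [lt_mem_nhds hx] with y hy
      rw [abs_of_pos hy]
    refine HasDerivAt.congr_of_eventuallyEq ?_ e
    have := ((hasDerivAt_id x).rpow_const (p := γ + 1) (Or.inl hx.ne')).div_const (γ + 1)
    refine this.congr_deriv ?_
    rw [spow_pos hγ hx]; simp; field_simp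

lemma rect_integral {β : ℝ} (hβ : -1 < β) {a b c d : ℝ} (ha : 0 ≤ a) (hab : a ≤ b) (hb : b ≤ 1)
    (hc : 0 ≤ c) (hcd : c ≤ d) (hd : d ≤ 1) :
    (β + 1) * (β + 2) * ∫ p in Set.Ioc a b ×ˢ Set.Ioc c d, |p.1 - p.2| ^ β =
      |b - c| ^ (β + 2) - |a - c| ^ (β + 2) - |b - d| ^ (β + 2) + |a - d| ^ (β + 2) := by
  have hint : IntegrableOn (fun p : ℝ × ℝ => |p.1 - p.2| ^ β) (Set.Ioc a b ×ˢ Set.Ioc c d) :=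
    (diag_int hβ).mono_set (Set.prod_mono
      (fun x hx => ⟨ha.trans hx.1.le, hx.2.trans hb⟩) (fun x hx => ⟨hc.trans hx.1.le, hx.2.trans hd⟩))
  have h1 : 0 < β + 1 := by linarith
  have h2 : 0 < β + 2 := by linarith
  rw [Measure.volume_eq_prod] at hint ⊢
  rw [setIntegral_prod _ hint, ← intervalIntegral.integral_of_le hab]
  have inner : ∀ u : ℝ, ∫ v in Set.Ioc c d, |u - v| ^ β =
      (spow (β + 1) (u - c) - spow (β + 1) (u - d)) / (β + 1) := by
    intro u
    rw [← intervalIntegral.integral_of_le hcd,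
      intervalIntegral.integral_comp_sub_left (fun x => |x| ^ β) u, integral_absrpow hβ]
  simp only [inner]
  have sc := spow_cont h1.le
  rw [intervalIntegral.integral_div, intervalIntegral.integral_sub
    (f := fun x => spow (β + 1) (x - c)) (g := fun x => spow (β + 1) (x - d))
    ((sc.comp (continuous_sub_right c)).intervalIntegrable _ _)
    ((sc.comp (continuous_sub_right d)).intervalIntegrable _ _),
    intervalIntegral.integral_comp_sub_right (fun x => spow (β + 1) x),
    intervalIntegral.integral_comp_sub_right (fun x => spow (β + 1) x),
    integral_spow h1, integral_spow h1]
  have e : β + 1 + 1 = β + 2 := by ring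
  rw [e]
  field_simp
  ring

/-- per-cell bounds -/
lemma cell_bounds {β : ℝ} (hβ0 : β ≤ 0) (q : ℕ) (hq : 1 ≤ q) (hβ : -1 < β * q)
    {a b c d : ℝ} (ha : 0 ≤ a) (hab : a < b) (hb : b ≤ 1)
    (hc : 0 ≤ c) (hcd : c < d) (hd : d ≤ 1) :
    (∫ p in Set.Ioc a b ×ˢ Set.Ioc c d, (|p.1 - p.2| + (b - a) + (d - c)) ^ (β * q)) ≤
      ((b - a) * (d - c)) * (((b - a) * (d - c))⁻¹ *
        ∫ p in Set.Ioc a b ×ˢ Set.Ioc c d, |p.1 - p.2| ^ β) ^ q ∧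
    ((b - a) * (d - c)) * (((b - a) * (d - c))⁻¹ *
        ∫ p in Set.Ioc a b ×ˢ Set.Ioc c d, |p.1 - p.2| ^ β) ^ q ≤
      ∫ p in Set.Ioc a b ×ˢ Set.Ioc c d, |p.1 - p.2| ^ (β * q) := by
  set K : Set (ℝ × ℝ) := Set.Ioc a b ×ˢ Set.Ioc c d with hK
  have hKm : MeasurableSet K := measurableSet_Ioc.prod measurableSet_Ioc
  have hsub : K ⊆ Set.Icc (0 : ℝ) 1 ×ˢ Set.Icc (0 : ℝ) 1 := Set.prod_mono
      (fun x hx => ⟨ha.trans hx.1.le, hx.2.trans hb⟩) (fun x hx => ⟨hc.trans hx.1.le, hx.2.trans hd⟩)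
  have hq1 : (1 : ℝ) ≤ q := by exact_mod_cast hq
  have hβ1 : -1 < β := by nlinarith
  have hi1 := (diag_int hβ1).mono_set hsub
  have hi2 := (diag_int hβ).mono_set hsub
  have hδ : 0 < b - a := by linarith
  have hη : 0 < d - c := by linarith
  set V := (b - a) * (d - c) with hV
  have hVpos : 0 < V := by positivity
  have hvol : volume.real K = V := by
    rw [hK, Measure.volume_eq_prod, measureReal_prod_prod]
    simp [measureReal_def, hδ.le, hη.le, hV]
  have hvol' : volume K = ENNReal.ofReal V := by
    rw [hK, Measure.volume_eq_prod, Measure.prod_prod]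
    simp [ENNReal.ofReal_mul hδ.le, hV]
  have hfin : volume K ≠ ⊤ := by rw [hvol']; simp
  have hfm : IsFiniteMeasure (volume.restrict K) := isFiniteMeasure_restrict.2 hfin
  set I := ∫ p in K, |p.1 - p.2| ^ β with hI
  have hpow : ∀ x : ℝ, 0 ≤ x → x ^ (β * q) = (x ^ β) ^ q := by
    intro x hx; rw [Real.rpow_mul hx, Real.rpow_natCast]
  constructor
  · have hlow : ∀ p ∈ K, (|p.1 - p.2| + (b - a) + (d - c)) ^ (β * q) ≤ (V⁻¹ * I) ^ q := by
      intro p hp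
      have h0 : 0 < |p.1 - p.2| + (b - a) + (d - c) := by positivity
      rw [hpow _ h0.le]
      gcongr
      rw [← div_eq_inv_mul, le_div_iff₀ hVpos]
      have : ∫ _p' in K, (|p.1 - p.2| + (b - a) + (d - c)) ^ β ≤ I := by
        refine setIntegral_mono_on_ae (integrable_const _) hi1 hKm ?_
        have := diag_ne_ae Set.univ
        rw [Measure.restrict_univ] at this
        filter_upwards [this] with p' hne hp'
        refine Real.rpow_le_rpow_of_nonpos (abs_pos.2 (sub_ne_zero.2 hne)) ?_ hβ0
        obtain ⟨⟨h1, h2⟩, h3, h4⟩ := hp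
        obtain ⟨⟨h5, h6⟩, h7, h8⟩ := hp'
        rw [abs_le]
        have e1 := neg_abs_le (p.1 - p.2)
        have e2 := le_abs_self (p.1 - p.2)
        constructor <;> linarith
      rw [setIntegral_const, hvol, smul_eq_mul] at this
      linarith
    calc _ ≤ ∫ _p in K, (V⁻¹ * I) ^ q := by
          refine setIntegral_mono_on ?_ (integrable_const _) hKm hlow
          refine Integrable.mono' (g := fun _ => (V⁻¹ * I) ^ q) (integrable_const _) ?_ ?_
          · exact Measurable.aestronglyMeasurable (by fun_prop)
          · filter_upwards [ae_restrict_mem hKm] with p hp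
            rw [Real.norm_of_nonneg (by positivity)]
            exact hlow p hp
      _ = _ := by rw [setIntegral_const, hvol, smul_eq_mul]
  · have J := (convexOn_pow q).map_set_average_le (μ := volume) (t := K)
      (f := fun p : ℝ × ℝ => |p.1 - p.2| ^ β) (by fun_prop) isClosed_Ici
      (by rw [hvol']; simpa using hVpos) hfin
      (Eventually.of_forall fun p => by simp; positivity) hi1
      (by
        refine hi2.congr_fun ?_ hKm
        intro p _
        simp [hpow])
    rw [setAverage_eq, setAverage_eq, hvol, smul_eq_mul, smul_eq_mul] at J
    rw [← hI] at J
    have e : ∫ p in K, |p.1 - p.2| ^ (β * q) = ∫ p in K, (|p.1 - p.2| ^ β) ^ q := by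
      congr 1; ext p; exact hpow _ (abs_nonneg _)
    rw [e]
    calc _ ≤ V * (V⁻¹ * ∫ p in K, (|p.1 - p.2| ^ β) ^ q) := by gcongr
      _ = _ := by field_simp

lemma Ioc_cells {n : ℕ} (hn : 0 < n) :
    Set.Ioc (0 : ℝ) 1 = ⋃ k ∈ Finset.range n, Set.Ioc ((k : ℝ) / n) (((k : ℝ) + 1) / n) := by
  have hm : Monotone (fun k : ℕ => (k : ℝ) / n) := by
    intro i j hij
    dsimp only
    gcongr
  have := hm.biUnion_Ico_Ioc_map_succ 0 n
  have hn' : (n : ℝ) ≠ 0 := by positivity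
  simp [div_self hn'] at this
  simpa using this.symm

lemma sum_cells {n m : ℕ} (hn : 0 < n) (hm : 0 < m) (g : ℝ × ℝ → ℝ)
    (hg : IntegrableOn g (Set.Icc (0 : ℝ) 1 ×ˢ Set.Icc (0 : ℝ) 1)) :
    ∑ k ∈ Finset.range n, ∑ l ∈ Finset.range m,
      ∫ p in Set.Ioc ((k : ℝ) / n) (((k : ℝ) + 1) / n) ×ˢ Set.Ioc ((l : ℝ) / m) (((l : ℝ) + 1) / m), g p
    = ∫ p in Set.Icc (0 : ℝ) 1 ×ˢ Set.Icc (0 : ℝ) 1, g p := by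
  have hae : (Set.Icc (0 : ℝ) 1 ×ˢ Set.Icc (0 : ℝ) 1 : Set (ℝ × ℝ)) =ᵐ[volume]
      (Set.Ioc (0 : ℝ) 1 ×ˢ Set.Ioc (0 : ℝ) 1 : Set (ℝ × ℝ)) := by
    rw [Measure.volume_eq_prod]
    exact Measure.set_prod_ae_eq Ioc_ae_eq_Icc.symm Ioc_ae_eq_Icc.symm
  rw [setIntegral_congr_set hae]
  have hu : (Set.Ioc (0 : ℝ) 1 ×ˢ Set.Ioc (0 : ℝ) 1 : Set (ℝ × ℝ)) =
      ⋃ i ∈ Finset.range n ×ˢ Finset.range m,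
        Set.Ioc ((i.1 : ℝ) / n) (((i.1 : ℝ) + 1) / n) ×ˢ
          Set.Ioc ((i.2 : ℝ) / m) (((i.2 : ℝ) + 1) / m) := by
    ext ⟨x, y⟩
    rw [Set.mem_prod]
    nth_rewrite 1 [Ioc_cells hn]
    rw [Ioc_cells hm]
    simp only [Set.mem_prod, Set.mem_iUnion, Finset.mem_product, Prod.exists, exists_prop]
    constructor
    · rintro ⟨⟨k, hk, hx⟩, l, hl, hy⟩; exact ⟨k, l, ⟨hk, hl⟩, hx, hy⟩
    · rintro ⟨k, l, ⟨hk, hl⟩, hx, hy⟩; exact ⟨⟨k, hk, hx⟩, l, hl, hy⟩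
  have disj : ∀ N : ℕ, 0 < N → Pairwise (Function.onFun Disjoint
      fun k : ℕ => Set.Ioc ((k : ℝ) / N) (((k : ℝ) + 1) / N)) := by
    intro N hN
    have hm : Monotone (fun k : ℕ => (k : ℝ) / N) := by
      intro i j hij
      dsimp only
      gcongr
    simpa using hm.pairwise_disjoint_on_Ioc_succ
  have hg' : IntegrableOn g (Set.Ioc (0 : ℝ) 1 ×ˢ Set.Ioc (0 : ℝ) 1) :=
    hg.mono_set (Set.prod_mono Set.Ioc_subset_Icc_self Set.Ioc_subset_Icc_self)
  rw [hu] at hg' ⊢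
  rw [integral_biUnion_finset _ (fun i _ => measurableSet_Ioc.prod measurableSet_Ioc), Finset.sum_product]
  · rintro ⟨k, l⟩ - ⟨k', l'⟩ - hne
    rw [Function.onFun, Set.disjoint_prod]
    by_cases h : k = k'
    · right
      exact disj m hm (fun h' => hne (Prod.ext h h'))
    · left
      exact disj n hn h
  · intro i hi
    exact hg'.mono_set (Set.subset_biUnion_of_mem (u := fun i : ℕ × ℕ => Set.Ioc ((i.1 : ℝ) / n) (((i.1 : ℝ) + 1) / n) ×ˢ
          Set.Ioc ((i.2 : ℝ) / m) (((i.2 : ℝ) + 1) / m)) hi)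

lemma dct {s : ℝ} (hs : -1 < s) (hs0 : s ≤ 0) :
    Tendsto (fun x : ℕ × ℕ => ∫ p in Set.Icc (0 : ℝ) 1 ×ˢ Set.Icc (0 : ℝ) 1,
      (|p.1 - p.2| + 1 / (x.1 : ℝ) + 1 / (x.2 : ℝ)) ^ s) atTop
      (𝓝 (∫ p in Set.Icc (0 : ℝ) 1 ×ˢ Set.Icc (0 : ℝ) 1, |p.1 - p.2| ^ s)) := by
  refine tendsto_integral_filter_of_dominated_convergence (fun p => |p.1 - p.2| ^ s) ?_ ?_
    (diag_int hs) ?_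
  · exact Eventually.of_forall fun x => Measurable.aestronglyMeasurable (by fun_prop)
  · refine Eventually.of_forall fun x => ?_
    filter_upwards [diag_ne_ae _] with p hp
    rw [Real.norm_of_nonneg (by positivity)]
    refine Real.rpow_le_rpow_of_nonpos (abs_pos.2 (sub_ne_zero.2 hp)) ?_ hs0
    have : 0 ≤ 1 / (x.1 : ℝ) := by positivity
    have : 0 ≤ 1 / (x.2 : ℝ) := by positivity
    linarith
  · filter_upwards [diag_ne_ae _] with p hp
    have h0 : Tendsto (fun x : ℕ × ℕ => |p.1 - p.2| + 1 / (x.1 : ℝ) + 1 / (x.2 : ℝ)) atTop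
        (𝓝 (|p.1 - p.2| + 0 + 0)) := by
      rw [← prod_atTop_atTop_eq]
      exact (tendsto_const_nhds.add (tendsto_one_div_atTop_nhds_zero_nat.comp tendsto_fst)).add
        (tendsto_one_div_atTop_nhds_zero_nat.comp tendsto_snd)
    rw [add_zero, add_zero] at h0
    exact h0.rpow_const (Or.inl (abs_pos.2 (sub_ne_zero.2 hp)).ne')

/-- the deterministic limit -/
lemma riemann_limit {β : ℝ} (hβ0 : β ≤ 0) (q : ℕ) (hq : 1 ≤ q) (hβ : -1 < β * q) :
    Tendsto (fun x : ℕ × ℕ => ∑ k ∈ Finset.range x.1, ∑ l ∈ Finset.range x.2,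
      ((1 / (x.1 : ℝ)) * (1 / (x.2 : ℝ))) * (((1 / (x.1 : ℝ)) * (1 / (x.2 : ℝ)))⁻¹ *
        ∫ p in Set.Ioc ((k : ℝ) / x.1) (((k : ℝ) + 1) / x.1) ×ˢ
          Set.Ioc ((l : ℝ) / x.2) (((l : ℝ) + 1) / x.2), |p.1 - p.2| ^ β) ^ q) atTop
      (𝓝 (∫ p in Set.Icc (0 : ℝ) 1 ×ˢ Set.Icc (0 : ℝ) 1, |p.1 - p.2| ^ (β * q))) := by
  have hs0 : β * q ≤ 0 := mul_nonpos_of_nonpos_of_nonneg hβ0 (by positivity)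
  have hev : ∀ᶠ x : ℕ × ℕ in atTop, 0 < x.1 ∧ 0 < x.2 := by
    filter_upwards [eventually_ge_atTop ((1, 1) : ℕ × ℕ)] with x hx
    exact ⟨hx.1, hx.2⟩
  have hcell : ∀ n k : ℕ, k < n → (0 : ℝ) ≤ (k : ℝ) / n ∧ (k : ℝ) / n < ((k : ℝ) + 1) / n ∧
      ((k : ℝ) + 1) / n ≤ 1 ∧ ((k : ℝ) + 1) / n - (k : ℝ) / n = 1 / n := by
    intro n k hk
    have hn : (0 : ℝ) < n := by exact_mod_cast (Nat.zero_le k).trans_lt hk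
    refine ⟨by positivity, by gcongr; linarith, ?_, by ring⟩
    rw [div_le_one hn]; exact_mod_cast hk
  refine tendsto_of_tendsto_of_tendsto_of_le_of_le' (dct hβ hs0) tendsto_const_nhds ?_ ?_
  · filter_upwards [hev] with x ⟨h1, h2⟩
    have hp : 0 < 1 / (x.1 : ℝ) := by positivity
    have hp2 : 0 < 1 / (x.2 : ℝ) := by positivity
    rw [← sum_cells h1 h2]
    · refine Finset.sum_le_sum fun k hk => Finset.sum_le_sum fun l hl => ?_
      obtain ⟨a1, a2, a3, a4⟩ := hcell _ _ (Finset.mem_range.1 hk)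
      obtain ⟨b1, b2, b3, b4⟩ := hcell _ _ (Finset.mem_range.1 hl)
      have := (cell_bounds hβ0 q hq hβ a1 a2 a3 b1 b2 b3).1
      rwa [a4, b4] at this
    · refine Integrable.mono' (diag_int hβ) (Measurable.aestronglyMeasurable (by fun_prop)) ?_
      filter_upwards [diag_ne_ae _] with p hp
      rw [Real.norm_of_nonneg (by positivity)]
      exact Real.rpow_le_rpow_of_nonpos (abs_pos.2 (sub_ne_zero.2 hp)) (by linarith) hs0
  · filter_upwards [hev] with x ⟨h1, h2⟩
    rw [← sum_cells h1 h2 _ (diag_int hβ)]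
    refine Finset.sum_le_sum fun k hk => Finset.sum_le_sum fun l hl => ?_
    obtain ⟨a1, a2, a3, a4⟩ := hcell _ _ (Finset.mem_range.1 hk)
    obtain ⟨b1, b2, b3, b4⟩ := hcell _ _ (Finset.mem_range.1 hl)
    have := (cell_bounds hβ0 q hq hβ a1 a2 a3 b1 b2 b3).2
    rwa [a4, b4] at this

lemma comb_gauss {Ω : Type*} {mΩ : MeasurableSpace Ω} (μ : Measure Ω) (B : ℝ → Ω → ℝ)
    (hGauss : ∀ s : Finset ℝ, (∀ t ∈ s, (0 : ℝ) ≤ t) → ∀ a : ℝ → ℝ, ∃ v : NNReal,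
      Measure.map (fun ω => ∑ t ∈ s, a t * B t ω) μ = gaussianReal 0 v)
    {t₁ t₂ t₃ t₄ : ℝ} (h₁ : 0 ≤ t₁) (h₂ : 0 ≤ t₂) (h₃ : 0 ≤ t₃) (h₄ : 0 ≤ t₄) (c₁ c₂ c₃ c₄ : ℝ) :
    ∃ v : NNReal, Measure.map (fun ω => c₁ * B t₁ ω + c₂ * B t₂ ω + c₃ * B t₃ ω + c₄ * B t₄ ω) μ =
      gaussianReal 0 v := by
  obtain ⟨v, hv⟩ := hGauss {t₁, t₂, t₃, t₄} (by simp [h₁, h₂, h₃, h₄])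
    (fun t => (if t = t₁ then c₁ else 0) + (if t = t₂ then c₂ else 0) + (if t = t₃ then c₃ else 0)
      + (if t = t₄ then c₄ else 0))
  refine ⟨v, ?_⟩
  rw [← hv]
  congr 1
  ext ω
  simp only [add_mul, Finset.sum_add_distrib, ite_mul, zero_mul, Finset.sum_ite_eq']
  simp

lemma pair_gauss {Ω : Type*} {mΩ : MeasurableSpace Ω} (μ : Measure Ω) (B : ℝ → Ω → ℝ)
    (hBmeas : ∀ t : ℝ, 0 ≤ t → Measurable (B t))
    (hGauss : ∀ s : Finset ℝ, (∀ t ∈ s, (0 : ℝ) ≤ t) → ∀ a : ℝ → ℝ, ∃ v : NNReal,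
      Measure.map (fun ω => ∑ t ∈ s, a t * B t ω) μ = gaussianReal 0 v)
    {t₁ t₂ t₃ t₄ : ℝ} (h₁ : 0 ≤ t₁) (h₂ : 0 ≤ t₂) (h₃ : 0 ≤ t₃) (h₄ : 0 ≤ t₄) (c d : ℝ) :
    HasGaussianLaw (fun ω => (c * (B t₁ ω - B t₂ ω), d * (B t₃ ω - B t₄ ω))) μ := by
  have m₁ := hBmeas _ h₁
  have m₂ := hBmeas _ h₂
  have m₃ := hBmeas _ h₃
  have m₄ := hBmeas _ h₄
  refine ⟨isGaussian_of_map_eq_gaussianReal fun L => ⟨0, ?_⟩⟩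
  obtain ⟨v, hv⟩ := comb_gauss μ B hGauss h₁ h₂ h₃ h₄ (L (1, 0) * c) (-(L (1, 0) * c))
    (L (0, 1) * d) (-(L (0, 1) * d))
  refine ⟨v, ?_⟩
  rw [← hv, Measure.map_map (by fun_prop) (by fun_prop)]
  congr 1
  ext ω
  have : ∀ x y : ℝ, L (x, y) = x * L (1, 0) + y * L (0, 1) := by
    intro x y
    have : (x, y) = x • ((1 : ℝ), (0 : ℝ)) + y • ((0 : ℝ), (1 : ℝ)) := by simp
    rw [this, map_add, map_smul, map_smul, smul_eq_mul, smul_eq_mul]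
  simp only [Function.comp, this (c * _)]
  ring

lemma norm_const {n : ℕ} (hn : 0 < n) (q : ℕ) (H : ℝ) :
    (n : ℝ) ^ ((q : ℝ) * (1 - H) - 1) * ((n : ℝ) ^ H) ^ q = (1 / (n : ℝ)) * (n : ℝ) ^ q := by
  have h : (0 : ℝ) < n := by exact_mod_cast hn
  rw [← Real.rpow_natCast ((n : ℝ) ^ H), ← Real.rpow_mul h.le, ← Real.rpow_add h,
    ← Real.rpow_natCast (n : ℝ) q, one_div, ← Real.rpow_neg_one, ← Real.rpow_add h]
  congr 1
  ring

/-- For `q ≥ 2`, `H ∈ (1 − 1/(2q), 1)` and a fBm `(B_t)_{t≥0}` with Hurst index `H`, with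
`Z_n = n^{q(1−H)−1} Σ_{k=0}^{n−1} H_q(n^H(B_{(k+1)/n} − B_{k/n}))`, as `n, m → ∞` jointly,
`E[Z_n Z_m] → q! H^q (2H−1)^q ∫_{[0,1]²} |u−v|^{(2H−2)q} du dv`, the limit being finite;
in particular `(Z_n)` is Cauchy in `L²(Ω)`. -/
theorem stmt16
    {Ω : Type*} {mΩ : MeasurableSpace Ω} (μ : Measure Ω) [IsProbabilityMeasure μ]
    (q : ℕ) (hq : 2 ≤ q)
    (H : ℝ) (hH1 : 1 - 1 / (2 * (q : ℝ)) < H) (hH2 : H < 1)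
    (B : ℝ → Ω → ℝ) (hBmeas : ∀ t : ℝ, 0 ≤ t → Measurable (B t))
    -- every finite real-linear combination of the `B_t`, `t ≥ 0`, is centered Gaussian
    (hGauss : ∀ s : Finset ℝ, (∀ t ∈ s, (0 : ℝ) ≤ t) → ∀ a : ℝ → ℝ, ∃ v : NNReal,
      Measure.map (fun ω => ∑ t ∈ s, a t * B t ω) μ = gaussianReal 0 v)
    -- fBm covariance structure
    (hcov : ∀ s t : ℝ, 0 ≤ s → 0 ≤ t → ∫ ω, B s ω * B t ω ∂μ =
      (1 / 2 : ℝ) * (t ^ (2 * H) + s ^ (2 * H) - |t - s| ^ (2 * H)))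
    -- `Z_n = n^{q(1−H)−1} Σ_{k=0}^{n−1} H_q(n^H(B_{(k+1)/n} − B_{k/n}))`
    (Z : ℕ → Ω → ℝ)
    (hZ : ∀ n ω, Z n ω = (n : ℝ) ^ ((q : ℝ) * (1 - H) - 1) *
      ∑ k ∈ Finset.range n,
        (Polynomial.aeval ((n : ℝ) ^ H * (B (((k : ℝ) + 1) / (n : ℝ)) ω - B ((k : ℝ) / (n : ℝ)) ω))
          (Polynomial.hermite q) : ℝ)) :
    -- the limiting integral is finite
    IntegrableOn (fun p : ℝ × ℝ => |p.1 - p.2| ^ ((2 * H - 2) * (q : ℝ)))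
      (Set.Icc (0 : ℝ) 1 ×ˢ Set.Icc (0 : ℝ) 1) ∧
    -- joint convergence of `E[Z_n Z_m]`
    Tendsto (fun p : ℕ × ℕ => ∫ ω, Z p.1 ω * Z p.2 ω ∂μ) atTop
      (𝓝 ((q.factorial : ℝ) * H ^ q * (2 * H - 1) ^ q *
        ∫ p in Set.Icc (0 : ℝ) 1 ×ˢ Set.Icc (0 : ℝ) 1,
          |p.1 - p.2| ^ ((2 * H - 2) * (q : ℝ)))) ∧
    -- `(Z_n)` is Cauchy in `L²(Ω)`
    (∀ ε : ℝ, 0 < ε → ∃ N : ℕ, ∀ n ≥ N, ∀ m ≥ N, ∫ ω, (Z n ω - Z m ω) ^ 2 ∂μ < ε) := by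
  have hq0 : (0 : ℝ) < q := by exact_mod_cast (by omega : 0 < q)
  have hq2 : (2 : ℝ) ≤ q := by exact_mod_cast hq
  have hβ : -1 < (2 * H - 2) * (q : ℝ) := by
    have h1 : (1 - 1 / (2 * (q : ℝ))) * (2 * q) < H * (2 * q) := by gcongr
    have h2 : (1 - 1 / (2 * (q : ℝ))) * (2 * q) = 2 * q - 1 := by field_simp
    nlinarith
  have hβ0 : 2 * H - 2 ≤ 0 := by linarith
  have hβ1 : -1 < 2 * H - 2 := by nlinarith
  have hH0 : 0 < H := by linarith
  -- moments of B
  have aB : ∀ t, 0 ≤ t → AllLp μ (B t) := by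
    intro t ht p hp
    have := (pair_gauss μ B hBmeas hGauss ht le_rfl ht ht 1 1).fst
    have h0 := (pair_gauss μ B hBmeas hGauss le_rfl le_rfl ht ht 1 1).fst
    obtain ⟨v, hv⟩ := comb_gauss μ B hGauss ht ht ht ht 1 0 0 0
    simp only [one_mul, zero_mul, add_zero] at hv
    have h3 : HasGaussianLaw (B t) μ := ⟨by
      have : (fun ω => B t ω) = B t := rfl
      rw [this] at hv
      rw [hv]; infer_instance⟩
    exact h3.memLp hp
  have cov4 : ∀ a b c d : ℝ, 0 ≤ a → 0 ≤ b → 0 ≤ c → 0 ≤ d →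
      ∫ ω, (B b ω - B a ω) * (B d ω - B c ω) ∂μ = (1 / 2 : ℝ) *
        (|b - c| ^ (2 * H) - |a - c| ^ (2 * H) - |b - d| ^ (2 * H) + |a - d| ^ (2 * H)) := by
    intro a b c d ha hb hc hd
    have e : ∀ ω, (B b ω - B a ω) * (B d ω - B c ω) =
      (B b ω * B d ω - B b ω * B c ω) - (B a ω * B d ω - B a ω * B c ω) := fun ω => by ring
    simp_rw [e]
    have i1 := ((aB b hb).mul (aB d hd)).integrable
    have i2 := ((aB b hb).mul (aB c hc)).integrable
    have i3 := ((aB a ha).mul (aB d hd)).integrable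
    have i4 := ((aB a ha).mul (aB c hc)).integrable
    rw [integral_sub (f := fun ω => B b ω * B d ω - B b ω * B c ω)
      (g := fun ω => B a ω * B d ω - B a ω * B c ω) (i1.sub i2) (i3.sub i4), integral_sub i1 i2, integral_sub i3 i4,
      hcov _ _ hb hd, hcov _ _ hb hc, hcov _ _ ha hd, hcov _ _ ha hc,
      abs_sub_comm d b, abs_sub_comm c b, abs_sub_comm d a, abs_sub_comm c a]
    ring
  set X : ℕ → ℕ → Ω → ℝ := fun n k ω =>
    (n : ℝ) ^ H * (B (((k : ℝ) + 1) / (n : ℝ)) ω - B ((k : ℝ) / (n : ℝ)) ω) with hXdef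
  have nn1 : ∀ n k : ℕ, (0 : ℝ) ≤ ((k : ℝ) + 1) / (n : ℝ) := fun n k => by positivity
  have nn2 : ∀ n k : ℕ, (0 : ℝ) ≤ (k : ℝ) / (n : ℝ) := fun n k => by positivity
  have pg : ∀ n k m l, HasGaussianLaw (fun ω => (X n k ω, X m l ω)) μ := fun n k m l =>
    pair_gauss μ B hBmeas hGauss (nn1 n k) (nn2 n k) (nn1 m l) (nn2 m l) _ _
  have aX : ∀ n k, AllLp μ (X n k) := fun n k p hp => (pg n k n k).fst.memLp hp
  have covX : ∀ n k m l, ∫ ω, X n k ω * X m l ω ∂μ = (n : ℝ) ^ H * (m : ℝ) ^ H *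
      ∫ ω, (B (((k : ℝ) + 1) / (n : ℝ)) ω - B ((k : ℝ) / (n : ℝ)) ω) *
        (B (((l : ℝ) + 1) / (m : ℝ)) ω - B ((l : ℝ) / (m : ℝ)) ω) ∂μ := by
    intro n k m l
    rw [← integral_const_mul]
    congr 1; ext ω; simp only [hXdef]; ring
  have lawX : ∀ n k, 0 < n → μ.map (X n k) = gaussianReal 0 1 := by
    intro n k hn
    have hn' : (0 : ℝ) < n := by exact_mod_cast hn
    obtain ⟨v, hv⟩ := comb_gauss μ B hGauss (nn1 n k) (nn2 n k) le_rfl le_rfl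
      ((n : ℝ) ^ H) (-(n : ℝ) ^ H) 0 0
    have e : (fun ω => (n : ℝ) ^ H * B (((k : ℝ) + 1) / (n : ℝ)) ω +
        -(n : ℝ) ^ H * B ((k : ℝ) / (n : ℝ)) ω + 0 * B 0 ω + 0 * B 0 ω) = X n k := by
      ext ω; simp only [hXdef]; ring
    rw [e] at hv
    have hm : AEMeasurable (X n k) μ := (pg n k n k).fst.aemeasurable
    have h2 : ∫ ω, X n k ω * X n k ω ∂μ = v := by
      have h1 := integral_map hm (f := fun x : ℝ => x * x) (by fun_prop)
      rw [← h1, hv]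
      have hvar := variance_fun_id_gaussianReal (μ := 0) (v := v)
      rw [variance_eq_integral (by fun_prop), integral_id_gaussianReal] at hvar
      rw [← hvar]
      congr 1; ext x; ring
    rw [covX, cov4 _ _ _ _ (nn2 n k) (nn1 n k) (nn2 n k) (nn1 n k)] at h2
    have e1 : ((k : ℝ) + 1) / n - k / n = 1 / n := by ring
    have e2 : (k : ℝ) / n - ((k : ℝ) + 1) / n = - (1 / n) := by ring
    rw [e1, e2, sub_self, sub_self, abs_neg, abs_zero, Real.zero_rpow (by positivity),
      abs_of_pos (by positivity), ← Real.rpow_add hn', one_div (n : ℝ), Real.inv_rpow hn'.le,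
      ← two_mul H] at h2
    have h3 : (0 : ℝ) < (n : ℝ) ^ (2 * H) := by positivity
    have : (v : ℝ) = 1 := by 
      rw [← h2]
      have h4 : (n : ℝ) ^ (2 * H) * ((n : ℝ) ^ (2 * H))⁻¹ = 1 := mul_inv_cancel₀ h3.ne'
      linear_combination h4
    rw [hv]
    congr 1
    exact_mod_cast this
  have aher : ∀ n k, AllLp μ (fun ω => (Polynomial.aeval (X n k ω) (Polynomial.hermite q) : ℝ)) := by
    intro n k
    have := (aX n k).poly ((Polynomial.hermite q).map (Int.castRingHom ℝ))
    simpa [Polynomial.aeval_def, Polynomial.eval_map] using this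
  have hZ' : ∀ n, Z n = fun ω => (n : ℝ) ^ ((q : ℝ) * (1 - H) - 1) *
      ∑ k ∈ Finset.range n, (Polynomial.aeval (X n k ω) (Polynomial.hermite q) : ℝ) :=
    fun n => funext (hZ n)
  have aZ : ∀ n, AllLp μ (Z n) := by
    intro n
    rw [hZ' n]
    exact (AllLp.const _).mul (AllLp.sum _ fun k _ => aher n k)
  have EZ : ∀ n m, 0 < n → 0 < m → ∫ ω, Z n ω * Z m ω ∂μ =
      ((q.factorial : ℝ) * H ^ q * (2 * H - 1) ^ q) *
      ∑ k ∈ Finset.range n, ∑ l ∈ Finset.range m,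
      ((1 / (n : ℝ)) * (1 / (m : ℝ))) * (((1 / (n : ℝ)) * (1 / (m : ℝ)))⁻¹ *
        ∫ p in Set.Ioc ((k : ℝ) / n) (((k : ℝ) + 1) / n) ×ˢ
          Set.Ioc ((l : ℝ) / m) (((l : ℝ) + 1) / m), |p.1 - p.2| ^ (2 * H - 2)) ^ q := by
    intro n m hn hm
    have hn' : (0 : ℝ) < n := by exact_mod_cast hn
    have hm' : (0 : ℝ) < m := by exact_mod_cast hm
    have e : ∀ ω, Z n ω * Z m ω = ∑ k ∈ Finset.range n, ∑ l ∈ Finset.range m,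
        ((n : ℝ) ^ ((q : ℝ) * (1 - H) - 1) * (m : ℝ) ^ ((q : ℝ) * (1 - H) - 1)) *
        ((Polynomial.aeval (X n k ω) (Polynomial.hermite q) : ℝ) *
          (Polynomial.aeval (X m l ω) (Polynomial.hermite q) : ℝ)) := by
      intro ω
      rw [hZ' n, hZ' m]
      simp only [← Finset.mul_sum]
      rw [mul_mul_mul_comm, Finset.sum_mul_sum]
      simp only [← Finset.mul_sum]
    simp_rw [e]
    have ii : ∀ k l, Integrable (fun ω =>
        ((n : ℝ) ^ ((q : ℝ) * (1 - H) - 1) * (m : ℝ) ^ ((q : ℝ) * (1 - H) - 1)) *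
        ((Polynomial.aeval (X n k ω) (Polynomial.hermite q) : ℝ) *
          (Polynomial.aeval (X m l ω) (Polynomial.hermite q) : ℝ))) μ := fun k l =>
      ((aher n k).mul (aher m l)).integrable.const_mul _
    rw [integral_finsetSum _ fun k _ => integrable_finsetSum _ fun l _ => ii k l, Finset.mul_sum]
    refine Finset.sum_congr rfl fun k hk => ?_
    rw [integral_finsetSum _ fun l _ => ii k l, Finset.mul_sum]
    refine Finset.sum_congr rfl fun l hl => ?_
    have hk1 : ((k : ℝ) + 1) / n ≤ 1 := by
      rw [div_le_one hn']; exact_mod_cast Finset.mem_range.1 hk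
    have hl1 : ((l : ℝ) + 1) / m ≤ 1 := by
      rw [div_le_one hm']; exact_mod_cast Finset.mem_range.1 hl
    have hR := rect_integral hβ1 (nn2 n k) (by gcongr; linarith) hk1 (nn2 m l)
      (by gcongr; linarith) hl1
    rw [show 2 * H - 2 + 2 = 2 * H by ring, show 2 * H - 2 + 1 = 2 * H - 1 by ring] at hR
    set I := ∫ p in Set.Ioc ((k : ℝ) / n) (((k : ℝ) + 1) / n) ×ˢ
          Set.Ioc ((l : ℝ) / m) (((l : ℝ) + 1) / m), |p.1 - p.2| ^ (2 * H - 2) with hI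
    rw [integral_const_mul, hermite_cov μ _ _ (pg n k m l) (lawX n k hn), covX,
      cov4 _ _ _ _ (nn2 n k) (nn1 n k) (nn2 m l) (nn1 m l), ← hR]
    have c1 := norm_const hn q H
    have c2 := norm_const hm q H
    calc _ = (q.factorial : ℝ) * (H * (2 * H - 1) * I) ^ q *
          (((n : ℝ) ^ ((q : ℝ) * (1 - H) - 1) * ((n : ℝ) ^ H) ^ q) *
          ((m : ℝ) ^ ((q : ℝ) * (1 - H) - 1) * ((m : ℝ) ^ H) ^ q)) := by
            rw [mul_pow, mul_pow, show 1 / 2 * ((2 * H - 1) * (2 * H) * I) = H * (2 * H - 1) * I by ring]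
            ring
      _ = _ := by
            rw [c1, c2]
            have : ((1 / (n : ℝ)) * (1 / (m : ℝ)))⁻¹ = (n : ℝ) * m := by field_simp
            rw [this]
            simp only [mul_pow]
            ring
  have lim : Tendsto (fun p : ℕ × ℕ => ∫ ω, Z p.1 ω * Z p.2 ω ∂μ) atTop
      (𝓝 ((q.factorial : ℝ) * H ^ q * (2 * H - 1) ^ q *
        ∫ p in Set.Icc (0 : ℝ) 1 ×ˢ Set.Icc (0 : ℝ) 1,
          |p.1 - p.2| ^ ((2 * H - 2) * (q : ℝ)))) := by
    refine ((riemann_limit hβ0 q (by omega) hβ).const_mul _).congr' ?_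
    filter_upwards [eventually_ge_atTop ((1, 1) : ℕ × ℕ)] with x hx
    exact (EZ x.1 x.2 hx.1 hx.2).symm
  refine ⟨diag_int hβ, lim, ?_⟩
  intro ε hε
  rw [Metric.tendsto_atTop] at lim
  obtain ⟨⟨N₁, N₂⟩, hN⟩ := lim (ε / 4) (by linarith)
  refine ⟨max N₁ N₂, fun n hn m hm => ?_⟩
  have hn1 := le_trans (le_max_left _ _) hn
  have hn2 := le_trans (le_max_right _ _) hn
  have hm1 := le_trans (le_max_left _ _) hm
  have hm2 := le_trans (le_max_right _ _) hm
  have b1 := hN (n, n) ⟨hn1, hn2⟩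
  have b2 := hN (n, m) ⟨hn1, hm2⟩
  have b3 := hN (m, m) ⟨hm1, hm2⟩
  rw [Real.dist_eq, abs_lt] at b1 b2 b3
  have e : ∀ ω, (Z n ω - Z m ω) ^ 2 = (Z n ω * Z n ω + Z m ω * Z m ω) - 2 * (Z n ω * Z m ω) :=
    fun ω => by ring
  simp_rw [e]
  have i1 := ((aZ n).mul (aZ n)).integrable
  have i2 := ((aZ m).mul (aZ m)).integrable
  have i3 := ((aZ n).mul (aZ m)).integrable
  rw [integral_sub (f := fun ω => Z n ω * Z n ω + Z m ω * Z m ω)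
    (g := fun ω => 2 * (Z n ω * Z m ω)) (i1.add i2) (i3.const_mul 2), integral_add i1 i2, integral_const_mul]
  simp only at b1 b2 b3
  linarith [b1.1, b1.2, b2.1, b2.2, b3.1, b3.2]
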